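/- Let d ≥ 1, let U ⊆ ℝᵈ be an open set, and let ω : ℝᵈ → ℝ be a function that is three times continuously differentiable on U and satisfies ∂ω/∂k_n(k) ≠ 0 for every k ∈ U and every n = 1,…,d. Let f : ℝᵈ → ℂ be twice continuously differentiable with compact support contained in U. Then there exists a constant c ≥ 0 such that for every real s ≠ 0, |∫_{ℝᵈ} e^{i s ω(k)} f(k) dk| ≤ c / s². -/

import Mathlib

open MeasureTheory

theorem integrable_mul_of_continuousOn_of_tsupport_subset {X : Type*} [TopologicalSpace X]
    [MeasurableSpace X] [OpensMeasurableSpace X] {μ : Measure X} [IsFiniteMeasureOnCompacts μ]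
    {U : Set X} (hU : IsOpen U) {e h : X → ℂ}
    (he : ContinuousOn e U) (hh : Continuous h) (hc : HasCompactSupport h)
    (hhU : tsupport h ⊆ U) : Integrable (fun x ↦ e x * h x) μ := by
  refine Continuous.integrable_of_hasCompactSupport ?_ hc.mul_left
  refine continuous_of_tsupport fun x hx ↦ ?_
  have hx' : x ∈ U := hhU (tsupport_mul_subset_right hx)
  exact (he.continuousAt (hU.mem_nhds hx')).mul hh.continuousAt

/-- The oscillating factor `e^{isω}`. -/
noncomputable def phaseFactor {X : Type*} (ω : X → ℝ) (s : ℝ) (x : X) : ℂ :=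
  Complex.exp (Complex.I * (s : ℂ) * (ω x : ℂ))

theorem norm_phaseFactor {X : Type*} (ω : X → ℝ) (s : ℝ) (x : X) : ‖phaseFactor ω s x‖ = 1 := by
  have : Complex.I * (s : ℂ) * (ω x : ℂ) = ((s * ω x : ℝ) : ℂ) * Complex.I := by
    push_cast; ring
  rw [phaseFactor, this, Complex.norm_exp_ofReal_mul_I]

section NonStationaryPhase

variable {E : Type*} [NormedAddCommGroup E] [NormedSpace ℝ E]

theorem ContDiff.of_contDiffAt_on_tsupport {F : Type*} [NormedAddCommGroup F] [NormedSpace ℝ F]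
    {n : WithTop ℕ∞} {g : E → F} (h : ∀ x ∈ tsupport g, ContDiffAt ℝ n g x) :
    ContDiff ℝ n g := by
  refine contDiff_iff_contDiffAt.2 fun x ↦ ?_
  by_cases hx : x ∈ tsupport g
  · exact h x hx
  · exact contDiffAt_const.congr_of_eventuallyEq (notMem_tsupport_iff_eventuallyEq.1 hx)

theorem hasFDerivAt_phaseFactor {ω : E → ℝ} {ω' : E →L[ℝ] ℝ} {x : E} (s : ℝ)
    (h : HasFDerivAt ω ω' x) :
    HasFDerivAt (phaseFactor ω s)
      (phaseFactor ω s x • (Complex.I * (s : ℂ)) • Complex.ofRealCLM.comp ω') x :=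
  ((Complex.ofRealCLM.hasFDerivAt.comp x h).const_mul (Complex.I * (s : ℂ))).cexp

variable [MeasurableSpace E] [BorelSpace E] [FiniteDimensional ℝ E]

/-- One integration by parts, along a direction in which the phase is nowhere stationary. -/
theorem exists_integral_phaseFactor_mul_eq (μ : Measure E) [μ.IsAddHaarMeasure]
    {U : Set E} (hU : IsOpen U) {ω : E → ℝ} {v : E} {n : ℕ}
    (hω : ContDiffOn ℝ (n + 2) ω U) (hω' : ∀ x ∈ U, fderiv ℝ ω x v ≠ 0)
    {f : E → ℂ} (hf : ContDiff ℝ (n + 1) f) (hfc : HasCompactSupport f) (hfU : tsupport f ⊆ U) :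
    ∃ h : E → ℂ, ContDiff ℝ n h ∧ HasCompactSupport h ∧ tsupport h ⊆ U ∧
      ∀ s : ℝ, s ≠ 0 → ∫ x, phaseFactor ω s x * f x ∂μ =
        Complex.I / s * ∫ x, phaseFactor ω s x * h x ∂μ := by
  set g : E → ℂ := fun x ↦ ((fderiv ℝ ω x v : ℝ) : ℂ)⁻¹ * f x with hg
  have hgf : tsupport g ⊆ tsupport f := tsupport_mul_subset_right
  have hgU : tsupport g ⊆ U := hgf.trans hfU
  have hgc : HasCompactSupport g := hfc.mul_left
  have hg_smooth : ContDiff ℝ (n + 1) g := by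
    refine ContDiff.of_contDiffAt_on_tsupport fun x hx ↦ ?_
    have hxU := hgU hx
    have hd : ContDiffAt ℝ (n + 1) (fun y ↦ fderiv ℝ ω y v) x :=
      ((hω.contDiffAt (hU.mem_nhds hxU)).fderiv_right (m := n + 1)
        (by rw [add_assoc, one_add_one_eq_two])).clm_apply contDiffAt_const
    have hd' : ContDiffAt ℝ (n + 1) (fun y ↦ ((fderiv ℝ ω y v : ℝ) : ℂ)) x :=
      Complex.ofRealCLM.contDiff.contDiffAt.comp x hd
    exact (hd'.inv (by exact_mod_cast hω' x hxU)).mul hf.contDiffAt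
  have hh_smooth : ContDiff ℝ n (fun x ↦ fderiv ℝ g x v) :=
    (hg_smooth.fderiv_right le_rfl).clm_apply contDiff_const
  have hhc : HasCompactSupport (fun x ↦ fderiv ℝ g x v) := hgc.fderiv_apply ℝ v
  have hhU : tsupport (fun x ↦ fderiv ℝ g x v) ⊆ U :=
    (tsupport_fderiv_apply_subset ℝ v).trans hgU
  refine ⟨fun x ↦ fderiv ℝ g x v, hh_smooth, hhc, hhU, fun s hs ↦ ?_⟩
  have hs' : (s : ℂ) ≠ 0 := by exact_mod_cast hs
  have hderiv : ∀ x ∈ U, HasFDerivAt (phaseFactor ω s)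
      (phaseFactor ω s x • (Complex.I * (s : ℂ)) • Complex.ofRealCLM.comp (fderiv ℝ ω x)) x :=
    fun x hx ↦ hasFDerivAt_phaseFactor s
      (((hω.contDiffAt (hU.mem_nhds hx)).differentiableAt (by positivity)).hasFDerivAt)
  have hcont : ContinuousOn (phaseFactor ω s) U :=
    fun x hx ↦ (hderiv x hx).continuousAt.continuousWithinAt
  have hfg : (fun x ↦ fderiv ℝ (phaseFactor ω s) x v * g x) =
      fun x ↦ Complex.I * s * (phaseFactor ω s x * f x) := by
    ext x
    by_cases hx : x ∈ tsupport f
    · have hne : ((fderiv ℝ ω x v : ℝ) : ℂ) ≠ 0 := by exact_mod_cast hω' x (hfU hx)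
      rw [(hderiv x (hfU hx)).fderiv, hg]
      simp only [smul_apply, ContinuousLinearMap.comp_apply,
        Complex.ofRealCLM_apply, smul_eq_mul]
      field_simp
    · simp [hg, image_eq_zero_of_notMem_tsupport hx]
  have key := integral_mul_fderiv_eq_neg_fderiv_mul_of_integrable (μ := μ) (v := v)
    (f := phaseFactor ω s) (g := g)
    (hfg ▸ (integrable_mul_of_continuousOn_of_tsupport_subset hU hcont hf.continuous hfc
      hfU).const_mul _)
    (integrable_mul_of_continuousOn_of_tsupport_subset hU hcont hh_smooth.continuous hhc hhU)
    (integrable_mul_of_continuousOn_of_tsupport_subset hU hcont hg_smooth.continuous hgc hgU)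
    (fun x hx ↦ (hderiv x (hgU hx)).differentiableAt)
    (fun x _ ↦ (hg_smooth.differentiable (by positivity)).differentiableAt)
  rw [key, hfg, integral_const_mul]
  field_simp
  simp [Complex.I_sq]

end NonStationaryPhase

/-- Lemma 2.5 (non-stationary phase estimate): if `ω` is `C³` on an open set `U ⊆ ℝᵈ`
with all first partial derivatives nonvanishing on `U`, and `f` is `C²` with compact
support contained in `U`, then `|∫ e^{isω(k)} f(k) dk| ≤ c / s²` for all `s ≠ 0`. -/
theorem stmt_3 {d : ℕ} (hd : 1 ≤ d)
    (U : Set (EuclideanSpace ℝ (Fin d))) (hU : IsOpen U)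
    (ω : EuclideanSpace ℝ (Fin d) → ℝ) (hω : ContDiffOn ℝ 3 ω U)
    (hω' : ∀ k ∈ U, ∀ n : Fin d, fderiv ℝ ω k (EuclideanSpace.single n 1) ≠ 0)
    (f : EuclideanSpace ℝ (Fin d) → ℂ) (hf : ContDiff ℝ 2 f)
    (hfsupp : HasCompactSupport f) (hfU : tsupport f ⊆ U) :
    ∃ c : ℝ, 0 ≤ c ∧ ∀ s : ℝ, s ≠ 0 →
      ‖∫ k : EuclideanSpace ℝ (Fin d),
          Complex.exp (Complex.I * (s : ℂ) * (ω k : ℂ)) * f k‖ ≤ c / s ^ 2 := by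
  have hne := fun k hk ↦ hω' k hk ⟨0, hd⟩
  obtain ⟨g, hg, hgc, hgU, hfg⟩ := exists_integral_phaseFactor_mul_eq volume hU (n := 1)
    (hω.of_le (by norm_num)) hne (hf.of_le (by norm_num)) hfsupp hfU
  obtain ⟨h, -, -, -, hgh⟩ := exists_integral_phaseFactor_mul_eq volume hU (n := 0)
    (hω.of_le (by norm_num)) hne (hg.of_le (by norm_num)) hgc hgU
  refine ⟨∫ k, ‖h k‖, integral_nonneg fun k ↦ norm_nonneg _, fun s hs ↦ ?_⟩
  have hbound : ‖∫ k, phaseFactor ω s k * h k‖ ≤ ∫ k, ‖h k‖ :=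
    (norm_integral_le_integral_norm _).trans_eq (by simp [norm_phaseFactor])
  calc ‖∫ k, phaseFactor ω s k * f k‖
      = ‖∫ k, phaseFactor ω s k * h k‖ / s ^ 2 := by
        rw [hfg s hs, hgh s hs]
        simp only [norm_mul, norm_div, Complex.norm_I, Complex.norm_real, Real.norm_eq_abs]
        rw [← sq_abs s]
        field_simp
    _ ≤ (∫ k, ‖h k‖) / s ^ 2 := by gcongr
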